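/- Let k ≥ 2, n ≥ 1, and let w ∈ S_n be a word of type n and length ℓ over the alphabet {0,…,k−1}. Let v be a word that can be written as a concatenation of s nonempty constant blocks a_1^{p_1} a_2^{p_2} ⋯ a_s^{p_s} with a_j ≠ a_{j+1} for all j (formally, v = L.bind (fun (p,a) => replicate p a) for a list L of length s of pairs with all first components positive and consecutive second components distinct). If v is a subsequence of w, then k·|v| ≤ ℓ + k·s·n (i.e. |v| = Σ p_j ≤ ℓ/k + s·n). -/

import Mathlib

/-- The block word `B(n) = 0^n 1^n ⋯ (k-1)^n` over the alphabet `{0, …, k-1}`. -/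
def blockWord (k n : ℕ) : List ℕ := (List.range k).flatMap fun a => List.replicate n a

/-- A word `w` is of type `n` (written `w ∈ S_n`) if, for some `m`, it is an infix of
`B(n)^m` or of the reversal of `B(n)^m`. -/
def IsTypeWord (k n : ℕ) (w : List ℕ) : Prop :=
  ∃ m : ℕ, w <:+: (List.replicate m (blockWord k n)).flatten ∨
    w <:+: (List.replicate m (blockWord k n)).flatten.reverse

theorem prefix_or_eq_append_of_prefix_append {α : Type*} {p x y : List α} (h : p <+: x ++ y) :
    p <+: x ∨ ∃ t, p = x ++ t ∧ t <+: y := by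
  rcases List.prefix_or_prefix_of_prefix h (List.prefix_append x y) with hp | ⟨t, rfl⟩
  · exact Or.inl hp
  · exact Or.inr ⟨t, rfl, (List.prefix_append_right_inj x).mp h⟩

theorem blockWord_succ (k n : ℕ) : blockWord (k + 1) n = blockWord k n ++ List.replicate n k := by
  simp [blockWord, List.range_succ]

theorem length_blockWord (k n : ℕ) : (blockWord k n).length = k * n := by
  simp [blockWord]

theorem lt_of_mem_blockWord {k n a : ℕ} (h : a ∈ blockWord k n) : a < k := by
  simp only [blockWord, List.mem_flatMap, List.mem_range, List.mem_replicate] at h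
  obtain ⟨b, hb, -, rfl⟩ := h
  exact hb

theorem count_prefix_blockWord {k n a : ℕ} (ha : a < k) {p : List ℕ}
    (hp : p <+: blockWord k n) : p.count a = min n (p.length - a * n) := by
  induction k generalizing p with
  | zero => omega
  | succ k ih =>
    rw [blockWord_succ] at hp
    rcases prefix_or_eq_append_of_prefix_append hp with hp | ⟨t, rfl, ht⟩
    · rcases Nat.lt_succ_iff_lt_or_eq.mp ha with h | rfl
      · exact ih h hp
      · have hle := hp.length_le
        rw [length_blockWord] at hle
        rw [List.count_eq_zero.mpr fun h => (lt_of_mem_blockWord (hp.subset h)).false]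
        omega
    · obtain ⟨htn, ht⟩ := List.prefix_replicate_iff.mp ht
      rw [List.count_append, List.length_append, length_blockWord]
      rcases Nat.lt_succ_iff_lt_or_eq.mp ha with h | rfl
      · have hmul : (a + 1) * n ≤ k * n := Nat.mul_le_mul_right n h
        rw [ih h (List.prefix_refl _), length_blockWord, ht, List.count_replicate,
          if_neg (by simpa using h.ne')]
        rw [Nat.add_mul] at hmul
        omega
      · rw [List.count_eq_zero.mpr fun h => (lt_of_mem_blockWord h).false, ht,
          List.count_replicate_self, List.length_replicate]
        omega

/-- In a prefix of a power of `B(n)`, the quantity `k * count a - length` stays in an interval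
of length `(k - 1) * n`. -/
theorem count_prefix_blockWord_pow {k n a m : ℕ} (ha : a < k) {p : List ℕ}
    (hp : p <+: (List.replicate m (blockWord k n)).flatten) :
    p.length ≤ k * p.count a + a * n ∧ k * p.count a + a * n + n ≤ p.length + k * n := by
  have hak : (a + 1) * n ≤ k * n := Nat.mul_le_mul_right n ha
  rw [Nat.add_mul, one_mul] at hak
  induction m generalizing p with
  | zero =>
    obtain rfl : p = [] := by simpa using hp
    simpa using hak
  | succ m ih =>
    rw [List.replicate_succ, List.flatten_cons] at hp
    rcases prefix_or_eq_append_of_prefix_append hp with hp | ⟨t, rfl, ht⟩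
    · have hc := count_prefix_blockWord ha hp
      have hle := hp.length_le
      rw [length_blockWord] at hle
      obtain ⟨j, rfl⟩ : ∃ j, k = j + 1 := ⟨k - 1, by omega⟩
      have hj : j * p.count a ≤ j * n := Nat.mul_le_mul_left j (by omega)
      simp only [Nat.add_mul, one_mul] at hak hle ⊢
      rcases le_total p.length (a * n) with h | h
      · have h0 : p.count a = 0 := by omega
        simp only [h0, mul_zero] at *
        omega
      · rcases le_total (p.length - a * n) n with h' | h'
        · omega
        · rw [min_eq_left h'] at hc
          rw [hc]
          omega
    · have hc := count_prefix_blockWord ha (List.prefix_refl (blockWord k n))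
      rw [length_blockWord, min_eq_left (by omega)] at hc
      have := ih ht
      rw [List.count_append, List.length_append, length_blockWord, hc, Nat.mul_add]
      omega

theorem count_infix_blockWord_pow {k n m : ℕ} (a : ℕ) {u : List ℕ}
    (hu : u <:+: (List.replicate m (blockWord k n)).flatten) :
    k * u.count a ≤ u.length + k * n := by
  rcases lt_or_ge a k with ha | ha
  · obtain ⟨x, y, h⟩ := hu
    have hx := count_prefix_blockWord_pow (p := x) ha ⟨u ++ y, by simpa using h⟩
    have hxu := count_prefix_blockWord_pow (p := x ++ u) ha ⟨y, h⟩
    rw [List.count_append, List.length_append, Nat.mul_add] at hxu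
    omega
  · have h0 : u.count a = 0 := List.count_eq_zero.mpr fun h => by
      obtain ⟨l, hl, hal⟩ := List.mem_flatten.mp (hu.subset h)
      rw [List.eq_of_mem_replicate hl] at hal
      exact absurd (lt_of_mem_blockWord hal) (by omega)
    simp [h0]

theorem IsTypeWord.count_le {k n : ℕ} {w : List ℕ} (hw : IsTypeWord k n w) (a : ℕ) :
    k * w.count a ≤ w.length + k * n := by
  obtain ⟨m, h | h⟩ := hw
  · exact count_infix_blockWord_pow a h
  · simpa using count_infix_blockWord_pow a (List.reverse_infix.mp (by simpa using h) :
      w.reverse <:+: (List.replicate m (blockWord k n)).flatten)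

theorem IsTypeWord.of_infix {k n : ℕ} {u w : List ℕ} (hw : IsTypeWord k n w) (h : u <:+: w) :
    IsTypeWord k n u :=
  hw.imp fun _ => Or.imp h.trans h.trans

theorem IsTypeWord.length_flatMap_replicate_le {k n : ℕ} {w : List ℕ} {L : List (ℕ × ℕ)}
    (hw : IsTypeWord k n w)
    (hL : (L.flatMap fun pa => List.replicate pa.1 pa.2).Sublist w) :
    k * (L.flatMap fun pa => List.replicate pa.1 pa.2).length ≤ w.length + k * L.length * n := by
  induction L generalizing w with
  | nil => simp
  | cons pa L ih =>
    rw [List.flatMap_cons, List.append_sublist_iff] at hL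
    obtain ⟨x, y, rfl, hx, hy⟩ := hL
    have hp : k * pa.1 ≤ k * x.count pa.2 :=
      Nat.mul_le_mul_left k (List.replicate_sublist_iff.mp hx)
    have hcount := (hw.of_infix (List.prefix_append x y).isInfix).count_le pa.2
    have hrec := ih (hw.of_infix (List.suffix_append x y).isInfix) hy
    rw [List.flatMap_cons, List.length_append, List.length_append, List.length_replicate,
      List.length_cons, Nat.mul_add, Nat.mul_add, Nat.add_mul, mul_one]
    omega

/-- Let `w ∈ S_n` have length `ℓ` and let `v` be a concatenation of `s`
nonempty constant blocks `a_1^{p_1} ⋯ a_s^{p_s}` with consecutive block letters distinct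
(formally `v = L.flatMap (fun pa => replicate pa.1 pa.2)` with `L` of length `s`, all first
components positive, and `Chain'` distinctness of second components).  If `v` is a
subsequence of `w`, then `k * |v| ≤ ℓ + k * s * n` (i.e. `|v| = Σ p_j ≤ ℓ/k + s·n`). -/
theorem block_decomposed_subseq_type_word_bound (k n ℓ s : ℕ) (hk : 2 ≤ k) (hn : 1 ≤ n)
    (w v : List ℕ) (L : List (ℕ × ℕ))
    (hw : IsTypeWord k n w) (hℓ : w.length = ℓ)
    (hs : L.length = s)
    (hpos : ∀ pa ∈ L, 0 < pa.1)
    (hdist : L.Chain' (fun x y => x.2 ≠ y.2))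
    (hvdef : v = L.flatMap (fun pa => List.replicate pa.1 pa.2))
    (hv : v.Sublist w) :
    k * v.length ≤ ℓ + k * s * n := by
  subst hvdef hℓ hs
  exact hw.length_flatMap_replicate_le hv
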